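/- arXiv:2408.04796 — 3 statements merged into one kernel-verified Lean document; each statement's English description precedes it below -/
import Mathlib

section
/- Let μ be a σ-finite measure on a measurable space X₁, let X₂ be a measurable space, let ν₁ and ν₀ be probability measures on X₂, and let p₁, p₀ : X₂ × X₁ → [0,∞) be measurable functions such that for every x₂, ∫ p₁(x₂,x₁) dμ(x₁) = 1 and ∫ p₀(x₂,x₁) dμ(x₁) = 1, and such that for (ν₁+ν₀)-a.e. x₂ and μ-a.e. x₁ one has p₁(x₂,x₁) > 0 ⟺ p₀(x₂,x₁) > 0 (equal supports). Fix π ∈ (0,1). Define ψ₀(x₁,x₂) = p₁(x₂,x₁)/p₀(x₂,x₁) on the common support. Let ψ : X₁ × X₂ → (0,∞) be any measurable function satisfying the normalization constraints: for (ν₁+ν₀)-a.e. x₂, ∫ p₀(x₂,x₁) ψ(x₁,x₂) dμ(x₁) = 1 and ∫ p₁(x₂,x₁) / ψ(x₁,x₂) dμ(x₁) = 1, and suppose the functions (x₂,x₁) ↦ p₁(x₂,x₁) log ψ(x₁,x₂), p₀ log ψ, p₁ log ψ₀, p₀ log ψ₀ are integrable with respect to ν₁ ⊗ μ and ν₀ ⊗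 μ as appropriate. Define the risk R(ψ) = −π ∫∫ p₁(x₂,x₁) log ψ(x₁,x₂) dμ(x₁) dν₁(x₂) + (1−π) ∫∫ p₀(x₂,x₁) log ψ(x₁,x₂) dμ(x₁) dν₀(x₂). Then R(ψ) ≥ R(ψ₀), and equality holds if and only if ψ = ψ₀ almost everywhere with respect to the measure π (ν₁-mixture of the kernels x₂ ↦ μ.withDensity p₁(x₂,·)) + (1−π) (ν₀-mixture of the kernels x₂ ↦ μ.withDensity p₀(x₂,·)). -/
open MeasureTheory Real

open InformationTheory in
/-- The Gibbs inequality for densities of equal mass, with its equality case. -/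
theorem integral_mul_log_div_nonneg_and_eq_zero_iff {α : Type*} [MeasurableSpace α]
    {M : Measure α} {p q : α → ℝ} (hp : Integrable p M) (hq : Integrable q M)
    (hp0 : ∀ᵐ a ∂M, 0 ≤ p a) (hq0 : ∀ᵐ a ∂M, 0 ≤ q a) (hpq : ∀ᵐ a ∂M, q a = 0 → p a = 0)
    (hmass : ∫ a, p a ∂M = ∫ a, q a ∂M)
    (hlog : Integrable (fun a => p a * log (p a / q a)) M) :
    0 ≤ ∫ a, p a * log (p a / q a) ∂M ∧
      (∫ a, p a * log (p a / q a) ∂M = 0 ↔ ∀ᵐ a ∂M, p a = q a) := by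
  have hkl : ∀ᵐ a ∂M, p a * log (p a / q a) - (p a - q a) = q a * klFun (p a / q a) := by
    filter_upwards [hpq] with a ha
    by_cases h : q a = 0
    · simp [h, ha h]
    · rw [klFun]
      field_simp
      ring
  have hnonneg : 0 ≤ᵐ[M] fun a => p a * log (p a / q a) - (p a - q a) := by
    filter_upwards [hkl, hp0, hq0] with a ha h1 h2
    rw [Pi.zero_apply, ha]
    exact mul_nonneg h2 (klFun_nonneg (div_nonneg h1 h2))
  have hint : ∫ a, (p a * log (p a / q a) - (p a - q a)) ∂M
      = ∫ a, p a * log (p a / q a) ∂M := by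
    rw [integral_sub (g := fun a => p a - q a) hlog (hp.sub hq), integral_sub hp hq, hmass,
      sub_self, sub_zero]
  rw [← hint]
  refine ⟨integral_nonneg_of_ae hnonneg, ?_⟩
  rw [integral_eq_zero_iff_of_nonneg_ae hnonneg (hlog.sub (hp.sub hq))]
  constructor
  · intro h
    filter_upwards [h, hkl, hp0, hq0, hpq] with a ha hkla h1 h2 h3
    by_cases hqa : q a = 0
    · rw [hqa, h3 hqa]
    · rw [hkla, Pi.zero_apply, mul_eq_zero, or_iff_right hqa,
        klFun_eq_zero_iff (div_nonneg h1 h2), div_eq_one_iff_eq hqa] at ha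
      exact ha
  · intro h
    filter_upwards [h] with a ha
    by_cases hqa : q a = 0 <;> simp [ha, hqa]

/-- A nonnegative family of functions of integral one is integrable on the product with a
probability measure, with integral one. -/
theorem integrable_prod_and_integral_eq_one {X Y : Type*} [MeasurableSpace X] [MeasurableSpace Y]
    {ν : Measure X} [IsProbabilityMeasure ν] {μ : Measure Y} [SigmaFinite μ] {f : X × Y → ℝ}
    (hf : Measurable f) (hf0 : ∀ z, 0 ≤ f z) (hone : ∀ᵐ x ∂ν, ∫ y, f (x, y) ∂μ = 1) :
    Integrable f (ν.prod μ) ∧ ∫ z, f z ∂(ν.prod μ) = 1 := by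
  have hint : Integrable f (ν.prod μ) := by
    rw [integrable_prod_iff hf.aestronglyMeasurable]
    constructor
    · filter_upwards [hone] with x hx
      exact integrable_of_integral_eq_one hx
    · refine (integrable_const (1 : ℝ)).congr ?_
      filter_upwards [hone] with x hx
      simp only [Real.norm_of_nonneg (hf0 _), hx]
  refine ⟨hint, ?_⟩
  rw [integral_prod f hint, integral_congr_ae hone]
  simp

/-- If `p` and `q = p v / u` are families of probability densities, then the iterated integral of
`p log v` is at most that of `p log u`, with equality iff `u = v` almost everywhere with respect to
the joint law of density `p`. -/
theorem integral_integral_mul_log_le_and_eq_iff {X Y : Type*} [MeasurableSpace X]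
    [MeasurableSpace Y] {ν : Measure X} [IsProbabilityMeasure ν] {μ : Measure Y} [SigmaFinite μ]
    {p q u v : X × Y → ℝ} (hp : Measurable p) (hq : Measurable q)
    (hp0 : ∀ z, 0 ≤ p z) (hq0 : ∀ z, 0 ≤ q z)
    (hpone : ∀ᵐ x ∂ν, ∫ y, p (x, y) ∂μ = 1) (hqone : ∀ᵐ x ∂ν, ∫ y, q (x, y) ∂μ = 1)
    (hsupp : ∀ᵐ z ∂(ν.prod μ), q z = 0 ↔ p z = 0)
    (huv : ∀ᵐ z ∂(ν.prod μ), 0 < p z → 0 < u z ∧ 0 < v z ∧ q z = p z * v z / u z)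
    (hu : Integrable (fun z => p z * log (u z)) (ν.prod μ))
    (hv : Integrable (fun z => p z * log (v z)) (ν.prod μ)) :
    ∫ x, ∫ y, p (x, y) * log (v (x, y)) ∂μ ∂ν ≤ ∫ x, ∫ y, p (x, y) * log (u (x, y)) ∂μ ∂ν ∧
      (∫ x, ∫ y, p (x, y) * log (v (x, y)) ∂μ ∂ν = ∫ x, ∫ y, p (x, y) * log (u (x, y)) ∂μ ∂ν ↔
        ∀ᵐ z ∂(ν.prod μ).withDensity (fun z => ENNReal.ofReal (p z)), u z = v z) := by
  have hlog : (fun z => p z * log (u z) - p z * log (v z))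
      =ᵐ[ν.prod μ] fun z => p z * log (p z / q z) := by
    filter_upwards [huv] with z hz
    rcases (hp0 z).eq_or_lt with h | h
    · simp [← h]
    · obtain ⟨h1, h2, h3⟩ := hz h
      rw [← mul_sub, ← log_div h1.ne' h2.ne', h3]
      congr 2
      field_simp
  obtain ⟨hpi, hp1⟩ := integrable_prod_and_integral_eq_one hp hp0 hpone
  obtain ⟨hqi, hq1⟩ := integrable_prod_and_integral_eq_one hq hq0 hqone
  obtain ⟨hnonneg, hzero⟩ := integral_mul_log_div_nonneg_and_eq_zero_iff hpi hqi
    (.of_forall hp0) (.of_forall hq0) (hsupp.mono fun _ h => h.1) (hp1.trans hq1.symm)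
    ((hu.sub hv).congr hlog)
  rw [← integral_congr_ae hlog, integral_sub hu hv, integral_prod _ hu, integral_prod _ hv]
    at hnonneg hzero
  refine ⟨sub_nonneg.1 hnonneg, ?_⟩
  rw [eq_comm, ← sub_eq_zero, hzero, ae_withDensity_iff hp.ennreal_ofReal]
  refine Filter.eventually_congr ?_
  filter_upwards [hsupp, huv] with z hs hz
  rcases (hp0 z).eq_or_lt with h | h
  · simp [← h, hs.2 h.symm]
  · obtain ⟨h1, h2, h3⟩ := hz h
    have hne : ENNReal.ofReal (p z) ≠ 0 := by simpa using h
    rw [h3, eq_div_iff h1.ne', mul_right_inj' h.ne']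
    simp [hne]

/-- Theorem 1 of the paper: for the conditional density ratio
`ψ₀(x₁,x₂) = p₁(x₂,x₁)/p₀(x₂,x₁)`, the risk
`R(ψ) = -pr ∫∫ p₁ log ψ dμ dν₁ + (1-pr) ∫∫ p₀ log ψ dμ dν₀`
of the loss `L(O,ψ) = -𝟙(λ=1) log ψ + 𝟙(λ=0) log ψ` is minimized over candidate
conditional density ratios `ψ` at `ψ₀`, with equality iff `ψ = ψ₀` a.e. with respect
to the mixture `pr • (joint law given λ=1) + (1-pr) • (joint law given λ=0)`. -/
theorem density_ratio_loss_qualified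
    {X₁ X₂ : Type*} [MeasurableSpace X₁] [MeasurableSpace X₂]
    (μ : Measure X₁) [SigmaFinite μ]
    (ν₁ ν₀ : Measure X₂) [IsProbabilityMeasure ν₁] [IsProbabilityMeasure ν₀]
    (p₁ p₀ : X₂ → X₁ → ℝ)
    (hp₁m : Measurable (Function.uncurry p₁)) (hp₀m : Measurable (Function.uncurry p₀))
    (hp₁0 : ∀ x₂ x₁, 0 ≤ p₁ x₂ x₁) (hp₀0 : ∀ x₂ x₁, 0 ≤ p₀ x₂ x₁)
    (hp₁int : ∀ x₂, ∫ x₁, p₁ x₂ x₁ ∂μ = 1) (hp₀int : ∀ x₂, ∫ x₁, p₀ x₂ x₁ ∂μ = 1)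
    (hsupp : ∀ᵐ x₂ ∂(ν₁ + ν₀), ∀ᵐ x₁ ∂μ, (0 < p₁ x₂ x₁ ↔ 0 < p₀ x₂ x₁))
    (pr : ℝ) (hpr : pr ∈ Set.Ioo (0 : ℝ) 1)
    (ψ : X₁ × X₂ → ℝ) (hψm : Measurable ψ) (hψpos : ∀ q, 0 < ψ q)
    (hnorm₁ : ∀ᵐ x₂ ∂(ν₁ + ν₀), ∫ x₁, p₀ x₂ x₁ * ψ (x₁, x₂) ∂μ = 1)
    (hnorm₂ : ∀ᵐ x₂ ∂(ν₁ + ν₀), ∫ x₁, p₁ x₂ x₁ / ψ (x₁, x₂) ∂μ = 1)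
    (ψ₀ : X₁ × X₂ → ℝ) (hψ₀ : ∀ q : X₁ × X₂, ψ₀ q = p₁ q.2 q.1 / p₀ q.2 q.1)
    (hint₁ : Integrable (fun q : X₂ × X₁ => p₁ q.1 q.2 * Real.log (ψ (q.2, q.1))) (ν₁.prod μ))
    (hint₂ : Integrable (fun q : X₂ × X₁ => p₀ q.1 q.2 * Real.log (ψ (q.2, q.1))) (ν₀.prod μ))
    (hint₃ : Integrable (fun q : X₂ × X₁ => p₁ q.1 q.2 * Real.log (ψ₀ (q.2, q.1))) (ν₁.prod μ))
    (hint₄ : Integrable (fun q : X₂ × X₁ => p₀ q.1 q.2 * Real.log (ψ₀ (q.2, q.1))) (ν₀.prod μ))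
    (R : (X₁ × X₂ → ℝ) → ℝ)
    (hR : ∀ φ : X₁ × X₂ → ℝ,
      R φ = -pr * ∫ x₂, ∫ x₁, p₁ x₂ x₁ * Real.log (φ (x₁, x₂)) ∂μ ∂ν₁
        + (1 - pr) * ∫ x₂, ∫ x₁, p₀ x₂ x₁ * Real.log (φ (x₁, x₂)) ∂μ ∂ν₀) :
    R ψ ≥ R ψ₀ ∧
      (R ψ = R ψ₀ ↔
        ∀ᵐ q : X₂ × X₁ ∂(ENNReal.ofReal pr •
            (ν₁.prod μ).withDensity (fun q => ENNReal.ofReal (p₁ q.1 q.2))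
          + ENNReal.ofReal (1 - pr) •
            (ν₀.prod μ).withDensity (fun q => ENNReal.ofReal (p₀ q.1 q.2))),
          ψ (q.2, q.1) = ψ₀ (q.2, q.1)) := by
  obtain ⟨hpr0, hpr1⟩ := hpr
  rw [ae_add_measure_iff] at hsupp hnorm₁ hnorm₂
  have hmeas : MeasurableSet {z : X₂ × X₁ | 0 < p₁ z.1 z.2 ↔ 0 < p₀ z.1 z.2} :=
    (measurableSet_lt measurable_const hp₁m).iff (measurableSet_lt measurable_const hp₀m)
  have hs₁ : ∀ᵐ z ∂(ν₁.prod μ), 0 < p₁ z.1 z.2 ↔ 0 < p₀ z.1 z.2 :=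
    (Measure.ae_prod_iff_ae_ae hmeas).2 hsupp.1
  have hs₀ : ∀ᵐ z ∂(ν₀.prod μ), 0 < p₁ z.1 z.2 ↔ 0 < p₀ z.1 z.2 :=
    (Measure.ae_prod_iff_ae_ae hmeas).2 hsupp.2
  have hψm' : Measurable fun z : X₂ × X₁ => ψ (z.2, z.1) := hψm.comp measurable_swap
  have hzero : ∀ z : X₂ × X₁, (0 < p₁ z.1 z.2 ↔ 0 < p₀ z.1 z.2) →
      (p₁ z.1 z.2 = 0 ↔ p₀ z.1 z.2 = 0) := by
    intro z hz
    rw [(hp₁0 _ _).lt_iff_ne', (hp₀0 _ _).lt_iff_ne'] at hz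
    exact not_iff_not.1 hz
  obtain ⟨hle₁, heq₁⟩ := integral_integral_mul_log_le_and_eq_iff (ν := ν₁) (μ := μ)
    (p := fun z => p₁ z.1 z.2) (q := fun z => p₀ z.1 z.2 * ψ (z.2, z.1))
    (u := fun z => ψ₀ (z.2, z.1)) (v := fun z => ψ (z.2, z.1))
    hp₁m (hp₀m.mul hψm') (fun _ => hp₁0 _ _) (fun _ => mul_nonneg (hp₀0 _ _) (hψpos _).le)
    (.of_forall hp₁int) hnorm₁.1
    (by
      filter_upwards [hs₁] with z hz
      simp [(hψpos (z.2, z.1)).ne', hzero z hz])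
    (by
      filter_upwards [hs₁] with z hz h
      have h' := hz.1 h
      simp only [hψ₀]
      refine ⟨div_pos h h', hψpos _, ?_⟩
      field_simp)
    hint₃ hint₁
  obtain ⟨hle₀, heq₀⟩ := integral_integral_mul_log_le_and_eq_iff (ν := ν₀) (μ := μ)
    (p := fun z => p₀ z.1 z.2) (q := fun z => p₁ z.1 z.2 / ψ (z.2, z.1))
    (u := fun z => ψ (z.2, z.1)) (v := fun z => ψ₀ (z.2, z.1))
    hp₀m (hp₁m.div hψm') (fun _ => hp₀0 _ _) (fun _ => div_nonneg (hp₁0 _ _) (hψpos _).le)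
    (.of_forall hp₀int) hnorm₂.2
    (by
      filter_upwards [hs₀] with z hz
      simp [(hψpos (z.2, z.1)).ne', hzero z hz])
    (by
      filter_upwards [hs₀] with z hz h
      have h' := hz.2 h
      simp only [hψ₀]
      refine ⟨hψpos _, div_pos h' h, ?_⟩
      field_simp)
    hint₂ hint₄
  have hc₁ : ENNReal.ofReal pr ≠ 0 := by simpa using hpr0
  have hc₀ : ENNReal.ofReal (1 - pr) ≠ 0 := by simpa using hpr1
  rw [hR, hR, ae_add_measure_iff, Measure.ae_ennreal_smul_measure_iff hc₁,
    Measure.ae_ennreal_smul_measure_iff hc₀, ← heq₀]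
  simp only [eq_comm (a := ψ _), ← heq₁]
  have h₁ := mul_le_mul_of_nonneg_left hle₁ hpr0.le
  have h₀ := mul_le_mul_of_nonneg_left hle₀ (sub_pos.2 hpr1).le
  refine ⟨by linarith, fun h => ⟨?_, ?_⟩, fun h => by rw [h.1, h.2]⟩
  · exact mul_left_cancel₀ hpr0.ne' (by linarith)
  · exact mul_left_cancel₀ (sub_pos.2 hpr1).ne' (by linarith)
end

section
/- Let μ be a σ-finite measure on a measurable space X and let f, g : X → [0,∞) be measurable with ∫ f dμ = 1 and ∫ g dμ = 1, such that μ-a.e. f(x) > 0 ⟺ g(x) > 0 (equal supports). Fix π ∈ (0,1). Let ψ : X → (0,∞) be measurable with ∫ g ψ dμ = 1 and ∫ f / ψ dμ = 1, and assume f log ψ, g log ψ, f log(f/g), and g log(f/g) are μ-integrable. Define R(ψ) = −π ∫ f log ψ dμ + (1−π) ∫ g log ψ dμ, and let ψ₀ = f/g on the common support. Then R(ψ) ≥ R(ψ₀), with equality if and only if ψ = ψ₀ almost everywhere with respect to μ restricted to the set {f > 0}. -/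
open MeasureTheory Real

/-- Pointwise form of the Gibbs inequality: `a - b * s ≤ a * (log (a / b) - log s)`. -/
lemma sub_mul_le_mul_log_div_sub_log {a b s : ℝ} (ha : 0 < a) (hb : 0 < b) (hs : 0 < s) :
    a - b * s ≤ a * (log (a / b) - log s) := by
  have hlog := log_le_sub_one_of_pos (show 0 < s / (a / b) by positivity)
  rw [log_div hs.ne' (by positivity)] at hlog
  have hmul := mul_le_mul_of_nonneg_left hlog ha.le
  have heq : a * (s / (a / b) - 1) = b * s - a := by field_simp
  linarith

/-- The pointwise Gibbs inequality is strict away from `s = a / b`. -/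
lemma sub_mul_lt_mul_log_div_sub_log {a b s : ℝ} (ha : 0 < a) (hb : 0 < b) (hs : 0 < s)
    (hne : s ≠ a / b) :
    a - b * s < a * (log (a / b) - log s) := by
  have hlog := log_lt_sub_one_of_pos (show 0 < s / (a / b) by positivity)
    (fun h => hne ((div_eq_one_iff_eq (by positivity)).1 h))
  rw [log_div hs.ne' (by positivity)] at hlog
  have hmul := mul_lt_mul_of_pos_left hlog ha
  have heq : a * (s / (a / b) - 1) = b * s - a := by field_simp
  linarith

/-- The pointwise Gibbs inequality with the roles of the two densities exchanged. -/
lemma sub_div_le_mul_log_sub_log_div {a b s : ℝ} (ha : 0 < a) (hb : 0 < b) (hs : 0 < s) :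
    b - a / s ≤ b * (log s - log (a / b)) := by
  have h := sub_mul_le_mul_log_div_sub_log hb ha (inv_pos.2 hs)
  rw [log_inv, ← inv_div a b, log_inv, ← div_eq_mul_inv] at h
  linarith

/-- Slice-wise form of Theorem 1: for probability densities `f`, `g` with respect to a
σ-finite measure `μ` with equal supports, and any candidate density ratio `ψ` satisfying
the normalization constraints `∫ g ψ = 1` and `∫ f / ψ = 1`, the risk
`R(ψ) = -pr ∫ f log ψ + (1-pr) ∫ g log ψ` is minimized at `ψ₀ = f / g`, with equality
iff `ψ = ψ₀` a.e. with respect to `μ` restricted to the support `{f > 0}`. -/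
theorem density_ratio_loss_slicewise
    {X : Type*} [MeasurableSpace X] (μ : Measure X) [SigmaFinite μ]
    (f g : X → ℝ) (hf : Measurable f) (hg : Measurable g)
    (hf0 : ∀ x, 0 ≤ f x) (hg0 : ∀ x, 0 ≤ g x)
    (hfint : ∫ x, f x ∂μ = 1) (hgint : ∫ x, g x ∂μ = 1)
    (hsupp : ∀ᵐ x ∂μ, (0 < f x ↔ 0 < g x))
    (pr : ℝ) (hpr : pr ∈ Set.Ioo (0 : ℝ) 1)
    (ψ : X → ℝ) (hψ : Measurable ψ) (hψpos : ∀ x, 0 < ψ x)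
    (hnorm₁ : ∫ x, g x * ψ x ∂μ = 1)
    (hnorm₂ : ∫ x, f x / ψ x ∂μ = 1)
    (hint₁ : Integrable (fun x => f x * Real.log (ψ x)) μ)
    (hint₂ : Integrable (fun x => g x * Real.log (ψ x)) μ)
    (hint₃ : Integrable (fun x => f x * Real.log (f x / g x)) μ)
    (hint₄ : Integrable (fun x => g x * Real.log (f x / g x)) μ)
    (R : (X → ℝ) → ℝ)
    (hR : ∀ φ : X → ℝ,
      R φ = -pr * ∫ x, f x * Real.log (φ x) ∂μ + (1 - pr) * ∫ x, g x * Real.log (φ x) ∂μ) :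
    R ψ ≥ R (fun x => f x / g x) ∧
      (R ψ = R (fun x => f x / g x) ↔
        ∀ᵐ x ∂(μ.restrict {x | 0 < f x}), ψ x = f x / g x) := by
  obtain ⟨hpr0, hpr1⟩ := hpr
  have hq : 0 < 1 - pr := sub_pos.2 hpr1
  have hif : Integrable f μ := .of_integral_ne_zero (by simp [hfint])
  have hig : Integrable g μ := .of_integral_ne_zero (by simp [hgint])
  have higψ : Integrable (fun x => g x * ψ x) μ := .of_integral_ne_zero (by simp [hnorm₁])
  have hifψ : Integrable (fun x => f x / ψ x) μ := .of_integral_ne_zero (by simp [hnorm₂])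
  let F : X → ℝ := fun x =>
    f x * log (f x / g x) - f x * log (ψ x) - (f x - g x * ψ x)
  let G : X → ℝ := fun x =>
    g x * log (ψ x) - g x * log (f x / g x) - (g x - f x / ψ x)
  have hF : Integrable F μ := (hint₃.sub hint₁).sub (hif.sub higψ)
  have hG : Integrable G μ := (hint₂.sub hint₄).sub (hig.sub hifψ)
  have hFint : ∫ x, F x ∂μ =
      ∫ x, f x * log (f x / g x) ∂μ - ∫ x, f x * log (ψ x) ∂μ := by
    refine (integral_sub (hint₃.sub hint₁) (hif.sub higψ)).trans ?_
    simp only [Pi.sub_apply]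
    rw [integral_sub hint₃ hint₁, integral_sub hif higψ, hfint, hnorm₁]
    ring
  have hGint : ∫ x, G x ∂μ =
      ∫ x, g x * log (ψ x) ∂μ - ∫ x, g x * log (f x / g x) ∂μ := by
    refine (integral_sub (hint₂.sub hint₄) (hig.sub hifψ)).trans ?_
    simp only [Pi.sub_apply]
    rw [integral_sub hint₂ hint₄, integral_sub hig hifψ, hgint, hnorm₂]
    ring
  have hexcess : R ψ - R (fun x => f x / g x) = ∫ x, (pr * F x + (1 - pr) * G x) ∂μ := by
    rw [integral_add (hF.const_mul _) (hG.const_mul _), integral_const_mul,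
      integral_const_mul, hFint, hGint, hR, hR]
    ring
  have hzero : ∀ x, (0 < f x ↔ 0 < g x) → ¬ 0 < f x → F x = 0 ∧ G x = 0 := by
    intro x hx hfx
    have hfx0 : f x = 0 := le_antisymm (not_lt.1 hfx) (hf0 x)
    have hgx0 : g x = 0 := le_antisymm (not_lt.1 (hx.not.1 hfx)) (hg0 x)
    simp [F, G, hfx0, hgx0]
  have hGpos : ∀ x, 0 < f x → 0 < g x → 0 ≤ G x := fun x hfx hgx => by
    have := sub_div_le_mul_log_sub_log_div hfx hgx (hψpos x)
    simp only [G]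
    linarith
  have hnonneg : 0 ≤ᵐ[μ] fun x => pr * F x + (1 - pr) * G x := by
    filter_upwards [hsupp] with x hx
    by_cases hfx : 0 < f x
    · have hFx : 0 ≤ F x := by
        have := sub_mul_le_mul_log_div_sub_log hfx (hx.1 hfx) (hψpos x)
        simp only [F]
        linarith
      have hGx := hGpos x hfx (hx.1 hfx)
      simp only [Pi.zero_apply]
      positivity
    · simp [hzero x hx hfx]
  refine ⟨sub_nonneg.1 (hexcess ▸ integral_nonneg_of_ae hnonneg), ?_⟩
  rw [← sub_eq_zero, hexcess, integral_eq_zero_iff_of_nonneg_ae hnonneg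
    ((hF.const_mul _).add (hG.const_mul _)),
    ae_restrict_iff' (measurableSet_lt measurable_const hf)]
  refine Filter.eventually_congr ?_
  filter_upwards [hsupp] with x hx
  simp only [Pi.zero_apply]
  constructor
  · intro h hfx
    by_contra hne
    have hFx : 0 < F x := by
      have := sub_mul_lt_mul_log_div_sub_log hfx (hx.1 hfx) (hψpos x) hne
      simp only [F]
      linarith
    have hGx := hGpos x hfx (hx.1 hfx)
    have : 0 < pr * F x + (1 - pr) * G x := by positivity
    exact this.ne' h
  · intro h
    by_cases hfx : 0 < f x
    · have hfne := hfx.ne'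
      have hgne := (hx.1 hfx).ne'
      have hFx : F x = 0 := by
        simp only [F, h hfx]
        field_simp
        ring
      have hGx : G x = 0 := by
        simp only [G, h hfx]
        field_simp
        ring
      simp [hFx, hGx]
    · simp [hzero x hx hfx]
end

section
/- Under the setup of Theorem 1 (σ-finite dominating measure μ on X₁; probability measures ν₁, ν₀ on X₂; conditional densities p₁, p₀ : X₂ × X₁ → [0,∞) integrating to 1 in x₁ for each x₂, with equal supports a.e.; π ∈ (0,1); measurable ψ : X₁ × X₂ → (0,∞) satisfying the normalization constraints ∫ p₀(x₂,x₁)ψ(x₁,x₂) dμ(x₁) = 1 and ∫ p₁(x₂,x₁)/ψ(x₁,x₂) dμ(x₁) = 1 for (ν₁+ν₀)-a.e. x₂, and with all logarithmic integrands integrable), the excess risk d(ψ,ψ₀) = R(ψ) − R(ψ₀) satisfies: d(ψ,ψ₀) = 0 if and only if, for (ν₁+ν₀)-a.e. x₂ and μ-a.e. x₁ in the common support, p₀(x₂,x₁) ψ(x₁,x₂) = p₁(x₂,x₁); equivalently, ψ agrees with ψ₀(x₁,x₂) = p₁(x₂,x₁)/p₀(x₂,x₁) almost surely. -/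
open MeasureTheory Real

/-- Nonnegativity of the relative entropy of `f` with respect to `g`, with its equality case. -/
lemma integral_mul_log_div_nonneg_and_eq_zero_iff_s3 {X : Type*} [MeasurableSpace X]
    {μ : Measure X} {f g l : X → ℝ} (hf : ∀ x, 0 ≤ f x) (hg : ∀ x, 0 ≤ g x)
    (hfi : Integrable f μ) (hgi : Integrable g μ) (hfg : ∫ x, f x ∂μ = ∫ x, g x ∂μ)
    (hsupp : ∀ᵐ x ∂μ, (0 < f x ↔ 0 < g x)) (hl : Integrable l μ)
    (hlog : ∀ᵐ x ∂μ, l x = f x * Real.log (f x / g x)) :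
    0 ≤ ∫ x, l x ∂μ ∧ (∫ x, l x ∂μ = 0 ↔ f =ᵐ[μ] g) := by
  have hpt : ∀ᵐ x ∂μ, 0 ≤ l x - (f x - g x) ∧ (l x - (f x - g x) = 0 → f x = g x) := by
    filter_upwards [hsupp, hlog] with x hs hx
    rcases (hf x).eq_or_lt with h | h
    · have hg0 : g x = 0 := le_antisymm (not_lt.1 fun hg' => (hs.2 hg').ne h) (hg x)
      simp [hx, ← h, hg0]
    · have hgx := hs.1 h
      have hinv : Real.log (f x / g x) = -Real.log (g x / f x) := by
        rw [← Real.log_inv, inv_div]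
      have hmul : f x * (g x / f x) = g x := by field_simp
      have hdiff : l x - (f x - g x) = f x * (g x / f x - 1 - Real.log (g x / f x)) := by
        rw [hx, hinv]
        linear_combination -hmul
      rw [hdiff]
      have hpos : 0 < g x / f x := div_pos hgx h
      refine ⟨mul_nonneg h.le (by linarith [Real.log_le_sub_one_of_pos hpos]), fun h0 => ?_⟩
      by_contra hne
      have hne1 : g x / f x ≠ 1 := fun h1 => hne ((div_eq_one_iff_eq h.ne').1 h1).symm
      have := Real.log_lt_sub_one_of_pos hpos hne1
      exact (mul_pos h (by linarith)).ne' h0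
  have hint : ∫ x, (l x - (f x - g x)) ∂μ = ∫ x, l x ∂μ := by
    rw [integral_sub hl (by exact hfi.sub hgi), integral_sub hfi hgi, hfg]
    ring
  have hnn : 0 ≤ᵐ[μ] fun x => l x - (f x - g x) := hpt.mono fun x hx => hx.1
  refine ⟨hint ▸ integral_nonneg_of_ae hnn, fun h0 => ?_, fun h => ?_⟩
  · have hz := (integral_eq_zero_iff_of_nonneg_ae hnn (hl.sub (hfi.sub hgi))).1 (hint.trans h0)
    filter_upwards [hz, hpt] with x hx hp
    exact hp.2 hx
  · refine integral_eq_zero_of_ae ?_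
    filter_upwards [h, hlog] with x hx hxl
    by_cases hg0 : g x = 0 <;> simp [hxl, hx, hg0]

/-- Nonnegativity of the averaged relative entropy between two families of densities, with its
equality case. -/
lemma integral_prod_mul_log_div_nonneg_and_eq_zero_iff {X Y : Type*} [MeasurableSpace X]
    [MeasurableSpace Y] {μ : Measure X} [SigmaFinite μ] {ν : Measure Y} [SFinite ν]
    {f g : Y → X → ℝ} {l : Y × X → ℝ} (hf : ∀ y x, 0 ≤ f y x) (hg : ∀ y x, 0 ≤ g y x)
    (hf1 : ∀ᵐ y ∂ν, ∫ x, f y x ∂μ = 1) (hg1 : ∀ᵐ y ∂ν, ∫ x, g y x ∂μ = 1)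
    (hsupp : ∀ᵐ y ∂ν, ∀ᵐ x ∂μ, (0 < f y x ↔ 0 < g y x)) (hl : Integrable l (ν.prod μ))
    (hlog : ∀ᵐ y ∂ν, ∀ᵐ x ∂μ, l (y, x) = f y x * Real.log (f y x / g y x)) :
    0 ≤ ∫ q, l q ∂(ν.prod μ) ∧
      (∫ q, l q ∂(ν.prod μ) = 0 ↔ ∀ᵐ y ∂ν, f y =ᵐ[μ] g y) := by
  have key : ∀ᵐ y ∂ν, 0 ≤ ∫ x, l (y, x) ∂μ ∧ (∫ x, l (y, x) ∂μ = 0 ↔ f y =ᵐ[μ] g y) := by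
    filter_upwards [hf1, hg1, hsupp, hlog, hl.prod_right_ae] with y h1 h2 h3 h4 h5
    exact integral_mul_log_div_nonneg_and_eq_zero_iff_s3 (hf y) (hg y)
      (.of_integral_ne_zero (by simp [h1])) (.of_integral_ne_zero (by simp [h2]))
      (h1.trans h2.symm) h3 h5 h4
  have hnn : 0 ≤ᵐ[ν] fun y => ∫ x, l (y, x) ∂μ := key.mono fun y hy => hy.1
  rw [integral_prod _ hl]
  refine ⟨integral_nonneg_of_ae hnn, ?_⟩
  rw [integral_eq_zero_iff_of_nonneg_ae hnn hl.integral_prod_left]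
  exact Filter.eventually_congr (key.mono fun y hy => hy.2)

/-- The equality condition concluding the proof of Theorem 1 of the paper: under the setup
of Theorem 1, the excess risk `d(ψ,ψ₀) = R(ψ) - R(ψ₀)` vanishes if and only if, for
`(ν₁+ν₀)`-a.e. `x₂` and `μ`-a.e. `x₁` in the common support,
`p₀(x₂,x₁) ψ(x₁,x₂) = p₁(x₂,x₁)`, i.e. `ψ` agrees with the density ratio
`ψ₀(x₁,x₂) = p₁(x₂,x₁)/p₀(x₂,x₁)` almost surely. -/
theorem excess_risk_eq_zero_iff
    {X₁ X₂ : Type*} [MeasurableSpace X₁] [MeasurableSpace X₂]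
    (μ : Measure X₁) [SigmaFinite μ]
    (ν₁ ν₀ : Measure X₂) [IsProbabilityMeasure ν₁] [IsProbabilityMeasure ν₀]
    (p₁ p₀ : X₂ → X₁ → ℝ)
    (hp₁m : Measurable (Function.uncurry p₁)) (hp₀m : Measurable (Function.uncurry p₀))
    (hp₁0 : ∀ x₂ x₁, 0 ≤ p₁ x₂ x₁) (hp₀0 : ∀ x₂ x₁, 0 ≤ p₀ x₂ x₁)
    (hp₁int : ∀ x₂, ∫ x₁, p₁ x₂ x₁ ∂μ = 1) (hp₀int : ∀ x₂, ∫ x₁, p₀ x₂ x₁ ∂μ = 1)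
    (hsupp : ∀ᵐ x₂ ∂(ν₁ + ν₀), ∀ᵐ x₁ ∂μ, (0 < p₁ x₂ x₁ ↔ 0 < p₀ x₂ x₁))
    (pr : ℝ) (hpr : pr ∈ Set.Ioo (0 : ℝ) 1)
    (ψ : X₁ × X₂ → ℝ) (hψm : Measurable ψ) (hψpos : ∀ q, 0 < ψ q)
    (hnorm₁ : ∀ᵐ x₂ ∂(ν₁ + ν₀), ∫ x₁, p₀ x₂ x₁ * ψ (x₁, x₂) ∂μ = 1)
    (hnorm₂ : ∀ᵐ x₂ ∂(ν₁ + ν₀), ∫ x₁, p₁ x₂ x₁ / ψ (x₁, x₂) ∂μ = 1)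
    (ψ₀ : X₁ × X₂ → ℝ) (hψ₀ : ∀ q : X₁ × X₂, ψ₀ q = p₁ q.2 q.1 / p₀ q.2 q.1)
    (hint₁ : Integrable (fun q : X₂ × X₁ => p₁ q.1 q.2 * Real.log (ψ (q.2, q.1))) (ν₁.prod μ))
    (hint₂ : Integrable (fun q : X₂ × X₁ => p₀ q.1 q.2 * Real.log (ψ (q.2, q.1))) (ν₀.prod μ))
    (hint₃ : Integrable (fun q : X₂ × X₁ => p₁ q.1 q.2 * Real.log (ψ₀ (q.2, q.1))) (ν₁.prod μ))
    (hint₄ : Integrable (fun q : X₂ × X₁ => p₀ q.1 q.2 * Real.log (ψ₀ (q.2, q.1))) (ν₀.prod μ))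
    (R : (X₁ × X₂ → ℝ) → ℝ)
    (hR : ∀ φ : X₁ × X₂ → ℝ,
      R φ = -pr * ∫ x₂, ∫ x₁, p₁ x₂ x₁ * Real.log (φ (x₁, x₂)) ∂μ ∂ν₁
        + (1 - pr) * ∫ x₂, ∫ x₁, p₀ x₂ x₁ * Real.log (φ (x₁, x₂)) ∂μ ∂ν₀)
    (d : ℝ) (hd : d = R ψ - R ψ₀) :
    (d = 0 ↔
      ∀ᵐ x₂ ∂(ν₁ + ν₀),
        ∀ᵐ x₁ ∂(μ.restrict {x₁ | 0 < p₁ x₂ x₁ ∧ 0 < p₀ x₂ x₁}),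
          p₀ x₂ x₁ * ψ (x₁, x₂) = p₁ x₂ x₁) ∧
    (d = 0 ↔
      ∀ᵐ x₂ ∂(ν₁ + ν₀),
        ∀ᵐ x₁ ∂(μ.restrict {x₁ | 0 < p₁ x₂ x₁ ∧ 0 < p₀ x₂ x₁}),
          ψ (x₁, x₂) = ψ₀ (x₁, x₂)) := by
  obtain ⟨hpr0, hpr1⟩ := hpr
  have hpr1' : 0 < 1 - pr := by linarith
  obtain ⟨hs₁, hs₀⟩ := ae_add_measure_iff.1 hsupp
  have hsupp₁ : ∀ᵐ x₂ ∂ν₁, ∀ᵐ x₁ ∂μ, (0 < p₁ x₂ x₁ ↔ 0 < p₀ x₂ x₁ * ψ (x₁, x₂)) := by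
    simpa only [mul_pos_iff_of_pos_right (hψpos _)] using hs₁
  have hsupp₀ : ∀ᵐ x₂ ∂ν₀, ∀ᵐ x₁ ∂μ, (0 < p₀ x₂ x₁ ↔ 0 < p₁ x₂ x₁ / ψ (x₁, x₂)) := by
    simpa only [div_pos_iff_of_pos_right (hψpos _), iff_comm] using hs₀
  have hlog₁ : ∀ᵐ x₂ ∂ν₁, ∀ᵐ x₁ ∂μ,
      p₁ x₂ x₁ * Real.log (ψ₀ (x₁, x₂)) - p₁ x₂ x₁ * Real.log (ψ (x₁, x₂)) =
        p₁ x₂ x₁ * Real.log (p₁ x₂ x₁ / (p₀ x₂ x₁ * ψ (x₁, x₂))) := by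
    filter_upwards [hs₁] with x₂ h
    filter_upwards [h] with x₁ hx
    rcases (hp₁0 x₂ x₁).eq_or_lt with h0 | h0
    · simp [← h0]
    · rw [hψ₀, ← div_div, Real.log_div (div_pos h0 (hx.1 h0)).ne' (hψpos _).ne']
      ring
  have hlog₀ : ∀ᵐ x₂ ∂ν₀, ∀ᵐ x₁ ∂μ,
      p₀ x₂ x₁ * Real.log (ψ (x₁, x₂)) - p₀ x₂ x₁ * Real.log (ψ₀ (x₁, x₂)) =
        p₀ x₂ x₁ * Real.log (p₀ x₂ x₁ / (p₁ x₂ x₁ / ψ (x₁, x₂))) := by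
    filter_upwards [hs₀] with x₂ h
    filter_upwards [h] with x₁ hx
    rcases (hp₀0 x₂ x₁).eq_or_lt with h0 | h0
    · simp [← h0]
    · rw [hψ₀, ← mul_sub, ← Real.log_div (hψpos _).ne' (div_pos (hx.2 h0) h0).ne']
      congr 2
      field_simp
  obtain ⟨hnn₁, hz₁⟩ := integral_prod_mul_log_div_nonneg_and_eq_zero_iff hp₁0
    (fun x₂ x₁ => mul_nonneg (hp₀0 x₂ x₁) (hψpos (x₁, x₂)).le) (.of_forall hp₁int)
    (ae_add_measure_iff.1 hnorm₁).1 hsupp₁ (hint₃.sub hint₁) hlog₁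
  obtain ⟨hnn₀, hz₀⟩ := integral_prod_mul_log_div_nonneg_and_eq_zero_iff hp₀0
    (fun x₂ x₁ => div_nonneg (hp₁0 x₂ x₁) (hψpos (x₁, x₂)).le) (.of_forall hp₀int)
    (ae_add_measure_iff.1 hnorm₂).2 hsupp₀ (hint₂.sub hint₄) hlog₀
  rw [integral_sub' hint₃ hint₁, integral_prod _ hint₃, integral_prod _ hint₁] at hnn₁ hz₁
  rw [integral_sub' hint₂ hint₄, integral_prod _ hint₂, integral_prod _ hint₄] at hnn₀ hz₀
  have hd0 : d = 0 ↔ ∀ᵐ x₂ ∂(ν₁ + ν₀), ∀ᵐ x₁ ∂μ, p₀ x₂ x₁ * ψ (x₁, x₂) = p₁ x₂ x₁ := by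
    have hd' := hd
    rw [hR, hR] at hd'
    have h₀ : ∀ x₂ x₁, p₀ x₂ x₁ = p₁ x₂ x₁ / ψ (x₁, x₂) ↔
        p₀ x₂ x₁ * ψ (x₁, x₂) = p₁ x₂ x₁ := fun x₂ x₁ => eq_div_iff (hψpos _).ne'
    simp only [Filter.EventuallyEq, h₀] at hz₀
    simp only [Filter.EventuallyEq, eq_comm (a := p₁ _ _)] at hz₁
    rw [ae_add_measure_iff, ← hz₁, ← hz₀]
    constructor
    · intro h
      have h₁ := mul_nonneg hpr0.le hnn₁
      have h₂ := mul_nonneg hpr1'.le hnn₀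
      exact ⟨(mul_eq_zero.1 (by linarith)).resolve_left hpr0.ne',
        (mul_eq_zero.1 (by linarith)).resolve_left hpr1'.ne'⟩
    · rintro ⟨h₁, h₂⟩
      linear_combination hd' + pr * h₁ + (1 - pr) * h₂
  have hmeas : ∀ x₂, MeasurableSet {x₁ | 0 < p₁ x₂ x₁ ∧ 0 < p₀ x₂ x₁} := fun x₂ =>
    (measurableSet_lt measurable_const hp₁m.of_uncurry_left).inter
      (measurableSet_lt measurable_const hp₀m.of_uncurry_left)
  have hres : d = 0 ↔ ∀ᵐ x₂ ∂(ν₁ + ν₀),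
      ∀ᵐ x₁ ∂(μ.restrict {x₁ | 0 < p₁ x₂ x₁ ∧ 0 < p₀ x₂ x₁}),
        p₀ x₂ x₁ * ψ (x₁, x₂) = p₁ x₂ x₁ := by
    rw [hd0]
    refine Filter.eventually_congr (hsupp.mono fun x₂ h => ?_)
    rw [ae_restrict_iff' (hmeas x₂)]
    refine Filter.eventually_congr (h.mono fun x₁ hx => ⟨fun he _ => he, fun he => ?_⟩)
    rcases (hp₁0 x₂ x₁).eq_or_lt with h0 | h0
    · have : p₀ x₂ x₁ = 0 := le_antisymm (not_lt.1 fun hp => (hx.2 hp).ne h0) (hp₀0 x₂ x₁)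
      simp [← h0, this]
    · exact he ⟨h0, hx.1 h0⟩
  refine ⟨hres, hres.trans (Filter.eventually_congr (.of_forall fun x₂ => ?_))⟩
  rw [ae_restrict_iff' (hmeas x₂), ae_restrict_iff' (hmeas x₂)]
  refine Filter.eventually_congr (.of_forall fun x₁ => forall_congr' fun hx => ?_)
  rw [hψ₀, eq_div_iff hx.2.ne', mul_comm]
end
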